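/- Let Φ be a lift of an orientation-preserving circle homeomorphism with rotation number ρ(Φ) = p/q (q ≥ 1). For every ε > 0 there exists N ∈ ℕ such that for every x ∈ ℝ the two-sided displacement sequence {η_n(x)}_{n∈ℤ} satisfies at least one of: (a) |η_{n+lq}(x) − η_n(x)| < ε for all n > N and all l ∈ ℕ; or (b) |η_{−(n+lq)}(x) − η_{−n}(x)| < ε for all n > N and all l ∈ ℕ. -/

import Mathlib

open Filter

lemma aux_int (f : ℝ → ℝ) (hl : ∀ x, f (x + 1) = f x + 1) (k : ℤ) (x : ℝ) :
    f (x + k) = f x + k := by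
  have hnat : ∀ (n : ℕ) (y : ℝ), f (y + n) = f y + n := by
    intro n
    induction n with
    | zero => intro y; simp
    | succ n ih =>
      intro y
      push_cast
      rw [← add_assoc, hl, ih]; ring
  obtain ⟨n, rfl | rfl⟩ := k.eq_nat_or_neg
  · simpa using hnat n x
  · have := hnat n (x + -(n : ℝ))
    push_cast
    rw [neg_add_cancel_right] at this
    linarith

lemma aux_iter (f : ℝ → ℝ) (hl : ∀ x, f (x + 1) = f x + 1) (n : ℕ) :
    ∀ x, f^[n] (x + 1) = f^[n] x + 1 := by
  induction n with
  | zero => intro x; rfl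
  | succ n ih =>
    intro x
    rw [Function.iterate_succ_apply, Function.iterate_succ_apply, hl, ih]

lemma aux_uc (f : ℝ → ℝ) (hc : Continuous f) (hl : ∀ x, f (x + 1) = f x + 1) :
    UniformContinuous f := by
  have h := (isCompact_Icc (a := (-1 : ℝ)) (b := 2)).uniformContinuousOn_of_continuous
    hc.continuousOn
  rw [Metric.uniformContinuousOn_iff] at h
  rw [Metric.uniformContinuous_iff]
  intro ε hε
  obtain ⟨δ, hδ, h⟩ := h ε hε
  refine ⟨min δ 1, lt_min hδ one_pos, ?_⟩
  intro a b hab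
  have h1 := lt_of_lt_of_le hab (min_le_left _ _)
  have h2 := lt_of_lt_of_le hab (min_le_right _ _)
  have e1 := aux_int f hl (-⌊a⌋) a
  have e2 := aux_int f hl (-⌊a⌋) b
  have f1 := Int.floor_le a
  have f2 := Int.lt_floor_add_one a
  rw [Real.dist_eq, abs_lt] at h2
  push_cast at e1 e2
  have := h (a + -(⌊a⌋ : ℝ)) ⟨by linarith, by linarith⟩ (b + -(⌊a⌋ : ℝ))
    ⟨by linarith, by linarith⟩ (by simpa using h1)
  rw [e1, e2] at this
  simpa using this

lemma aux_unif (f : ℝ → ℝ) (hf : UniformContinuous f) (ε : ℝ) (hε : 0 < ε) (q : ℕ) :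
    ∃ δ > 0, ∀ r < q, ∀ u v : ℝ, |u - v| < δ → |f^[r] u - f^[r] v| < ε := by
  induction q with
  | zero => exact ⟨1, one_pos, by simp⟩
  | succ q ih =>
    obtain ⟨δ, hδ, h⟩ := ih
    obtain ⟨δ', hδ', h'⟩ := Metric.uniformContinuous_iff.1 (UniformContinuous.iterate f q hf) ε hε
    refine ⟨min δ δ', lt_min hδ hδ', ?_⟩
    intro r hr u v huv
    rcases Nat.lt_succ_iff_lt_or_eq.1 hr with hr | rfl
    · exact h r hr u v (lt_of_lt_of_le huv (min_le_left _ _))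
    · exact h' (lt_of_lt_of_le huv (min_le_right _ _))

lemma aux_c (G : ℝ → ℝ) (hc : Continuous G) (hl : ∀ x, G (x + 1) = G x + 1)
    (δ : ℝ) (hδ : 0 < δ) :
    ∃ c > 0, ∀ z, (∀ w, G w = w → δ ≤ |z - w|) → c ≤ |G z - z| := by
  let S : Set ℝ := {z | ∀ w, G w = w → δ ≤ |z - w|}
  have hS : IsClosed S := by
    have : S = ⋂ w, ⋂ (_ : G w = w), {z | δ ≤ |z - w|} := by ext; simp [S]
    rw [this]
    refine isClosed_iInter fun w => isClosed_iInter fun _ => isClosed_le (by fun_prop) (by fun_prop)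
  have hK : IsCompact (Set.Icc (0 : ℝ) 1 ∩ S) := isCompact_Icc.inter_right hS
  have key : ∃ c > 0, ∀ z ∈ Set.Icc (0 : ℝ) 1 ∩ S, c ≤ |G z - z| := by
    rcases (Set.Icc (0 : ℝ) 1 ∩ S).eq_empty_or_nonempty with he | hne
    · exact ⟨1, one_pos, by simp [he]⟩
    · obtain ⟨z, hz, hmin⟩ := hK.exists_isMinOn hne
        (f := fun z => |G z - z|) (by fun_prop)
      refine ⟨|G z - z|, ?_, fun y hy => hmin hy⟩
      rw [gt_iff_lt, abs_pos, sub_ne_zero]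
      intro h
      have := hz.2 z h
      simp at this
      linarith
  obtain ⟨c, hc0, hcm⟩ := key
  refine ⟨c, hc0, fun z hz => ?_⟩
  have e1 := aux_int G hl (-⌊z⌋) z
  have f1 := Int.floor_le z
  have f2 := Int.lt_floor_add_one z
  push_cast at e1
  have := hcm (z + -(⌊z⌋ : ℝ)) ⟨⟨by linarith, by linarith⟩, ?_⟩
  · rw [e1] at this
    simpa using this
  · intro w hw
    have e2 := aux_int G hl ⌊z⌋ w
    have := hz (w + ⌊z⌋) (by rw [e2, hw])
    convert this using 2
    ring

lemma aux_B0 (G H : ℝ → ℝ) (hc : Continuous G) (hm : StrictMono G) (hmH : StrictMono H)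
    (hl : ∀ x, G (x + 1) = G x + 1)
    (h1 : Function.LeftInverse H G) (h2 : Function.RightInverse H G)
    (w₀ : ℝ) (hw₀ : G w₀ = w₀) (δ : ℝ) (hδ : 0 < δ) :
    ∃ M : ℕ, ∀ x, x ≤ G x →
      (∀ m ≥ M, ∀ l, |G^[m + l] x - G^[m] x| < δ) ∨
      (∀ m : ℕ, ∀ l, |H^[m + l] x - H^[m] x| < δ) := by
  obtain ⟨c, hc0, hcm⟩ := aux_c G hc hl δ hδ
  obtain ⟨M, hM⟩ := exists_nat_gt (1 / c)
  rw [div_lt_iff₀ hc0] at hM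
  refine ⟨M, fun x hx => ?_⟩
  by_contra! hcon
  obtain ⟨⟨m, hmM, l, hml⟩, m', l', hml'⟩ := hcon
  have hup : Monotone fun n : ℕ => G^[n] x := hm.monotone.monotone_iterate_of_le_map hx
  have hHx : H x ≤ x := by
    have := hmH.monotone hx
    rwa [h1 x] at this
  have hdn : Antitone fun n : ℕ => H^[n] x := hmH.monotone.antitone_iterate_of_map_le hHx
  have hstep : ∀ j < M, c ≤ G^[j + 1] x - G^[j] x := by
    intro j hj
    have hnn : G^[j] x ≤ G^[j + 1] x := hup (Nat.le_succ j)
    have := hcm (G^[j] x) ?_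
    · rw [← Function.iterate_succ_apply' G, abs_of_nonneg (by simpa using hnn)] at this
      exact this
    · intro w hw
      have hGw : ∀ n, G^[n] w = w := Function.iterate_fixed hw
      have hHw : ∀ n, H^[n] w = w := Function.iterate_fixed (by
        have := h1 w
        rwa [hw] at this)
      rcases le_total w (G^[j] x) with hle | hle
      · have hwx : w ≤ x := by
          rw [← hGw j] at hle
          exact (hm.iterate j).le_iff_le.1 hle
        have a1 : w ≤ H^[m' + l'] x := by
          have := (hmH.iterate (m' + l')).monotone hwx
          rwa [hHw] at this
        have a2 : H^[m' + l'] x ≤ H^[m'] x := hdn (Nat.le_add_right _ _)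
        have a3 : H^[m'] x ≤ H^[0] x := hdn (Nat.zero_le _)
        have a4 : G^[0] x ≤ G^[j] x := hup (Nat.zero_le _)
        simp only [Function.iterate_zero, id] at a3 a4
        rw [abs_of_nonpos (by linarith)] at hml'
        rw [abs_of_nonneg (by linarith)]
        linarith
      · have hwx : x ≤ w := by
          rw [← hGw j] at hle
          exact (hm.iterate j).le_iff_le.1 hle
        have a1 : G^[m + l] x ≤ w := by
          have := (hm.iterate (m + l)).monotone hwx
          rwa [hGw] at this
        have a2 : G^[m] x ≤ G^[m + l] x := hup (Nat.le_add_right _ _)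
        have a3 : G^[j] x ≤ G^[m] x := hup (by omega)
        rw [abs_of_nonneg (by linarith)] at hml
        rw [abs_of_nonpos (by linarith)]
        linarith
  have hsum : ∀ j ≤ M, x + j * c ≤ G^[j] x := by
    intro j
    induction j with
    | zero => intro _; simp
    | succ j ih =>
      intro hj
      have b1 := ih (by omega)
      have b2 := hstep j (by omega)
      push_cast
      linarith
  have hk := aux_int G hl (⌊x - w₀⌋ + 1) w₀
  rw [hw₀] at hk
  have hkf := Function.iterate_fixed hk M
  have f1 := Int.floor_le (x - w₀)
  have f2 := Int.lt_floor_add_one (x - w₀)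
  have := (hm.iterate M).monotone (show x ≤ w₀ + ((⌊x - w₀⌋ + 1 : ℤ) : ℝ) by push_cast; linarith)
  rw [hkf] at this
  push_cast at this
  have := hsum M le_rfl
  linarith

lemma aux_B (G H : ℝ → ℝ) (hc : Continuous G) (hcH : Continuous H)
    (hm : StrictMono G) (hmH : StrictMono H)
    (hl : ∀ x, G (x + 1) = G x + 1) (hlH : ∀ x, H (x + 1) = H x + 1)
    (h1 : Function.LeftInverse H G) (h2 : Function.RightInverse H G)
    (w₀ : ℝ) (hw₀ : G w₀ = w₀) (δ : ℝ) (hδ : 0 < δ) :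
    ∃ M : ℕ, ∀ x,
      (∀ m ≥ M, ∀ l, |G^[m + l] x - G^[m] x| < δ) ∨
      (∀ m ≥ M, ∀ l, |H^[m + l] x - H^[m] x| < δ) := by
  obtain ⟨M, hM⟩ := aux_B0 G H hc hm hmH hl h1 h2 w₀ hw₀ δ hδ
  obtain ⟨M', hM'⟩ := aux_B0 H G hcH hmH hm hlH h2 h1 w₀
    (by have := h1 w₀; rwa [hw₀] at this) δ hδ
  refine ⟨max M M', fun x => ?_⟩
  rcases le_total x (G x) with hx | hx
  · rcases hM x hx with h | h
    · exact Or.inl fun m hm => h m (le_trans (le_max_left _ _) hm)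
    · exact Or.inr fun m _ => h m
  · have hx' : x ≤ H x := by
      have := hmH.monotone hx
      rwa [h1 x] at this
    rcases hM' x hx' with h | h
    · exact Or.inr fun m hm => h m (le_trans (le_max_right _ _) hm)
    · exact Or.inl fun m _ => h m

lemma aux_G_iter (f : ℝ → ℝ) (hl : ∀ x, f (x + 1) = f x + 1) (q : ℕ) (p : ℤ) (m : ℕ) (x : ℝ) :
    f^[m * q] x = (fun y => f^[q] y - p)^[m] x + ((m * p : ℤ) : ℝ) := by
  induction m with
  | zero => simp
  | succ m ih =>
    rw [Function.iterate_succ_apply', add_mul, one_mul, add_comm, Function.iterate_add_apply, ih,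
      aux_int _ (aux_iter f hl q)]
    push_cast
    ring

lemma aux_C (f : ℝ → ℝ) (hl : ∀ x, f (x + 1) = f x + 1) (q : ℕ) (hq : 1 ≤ q) (p : ℤ)
    (δ ε : ℝ) (M : ℕ) (x : ℝ)
    (hu : ∀ r < q, ∀ u v : ℝ, |u - v| < δ → |f^[r] u - f^[r] v| < ε)
    (h : ∀ m ≥ M, ∀ l, |(fun y => f^[q] y - p)^[m + l] x - (fun y => f^[q] y - p)^[m] x| < δ) :
    ∀ n ≥ M * q, ∀ l : ℕ, |f^[n + l * q] x - l * p - f^[n] x| < ε := by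
  intro n hn l
  have hmod := Nat.mod_lt n hq
  have hdiv : n % q + (n / q) * q = n := by rw [mul_comm]; exact Nat.mod_add_div n q
  have hMd : M ≤ n / q := (Nat.le_div_iff_mul_le hq).2 hn
  generalize n % q = r at *
  generalize n / q = m at *
  subst hdiv
  have e : r + m * q + l * q = r + (m + l) * q := by ring
  rw [e, Function.iterate_add_apply, Function.iterate_add_apply f r (m * q),
    aux_G_iter f hl q p, aux_G_iter f hl q p, aux_int _ (aux_iter f hl r),
    aux_int _ (aux_iter f hl r)]
  have := hu r hmod _ _ (h m hMd l)
  convert this using 2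
  push_cast
  ring




/-- For a lift `Φ` (with inverse `Φi`) of a circle homeomorphism with
rotation number `p/q`, for each `ε > 0` there is `N`, uniform in `x`, such that the
two-sided displacement sequence `η n x = Φ^n x - Φ^(n-1) x`, `n ∈ ℤ`, is `ε`-almost
`q`-periodic for `n > N` in forward or in backward time. -/
theorem displacement_uniform_semi_periodicity
    (Φ Φi : ℝ → ℝ) (hcont : Continuous Φ) (hmono : StrictMono Φ)
    (hbij : Function.Bijective Φ) (hlift : ∀ x : ℝ, Φ (x + 1) = Φ x + 1)
    (hinv₁ : Function.LeftInverse Φi Φ) (hinv₂ : Function.RightInverse Φi Φ)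
    (p : ℤ) (q : ℕ) (hq : 1 ≤ q)
    (hrot : ∀ x : ℝ, Tendsto (fun n : ℕ => Φ^[n] x / n) atTop (nhds ((p : ℝ) / (q : ℝ))))
    (ε : ℝ) (hε : 0 < ε) :
    ∃ N : ℕ, ∀ x : ℝ,
      (∀ n : ℕ, n > N → ∀ l : ℕ,
        |(Φ^[n + l * q] x - Φ^[n + l * q - 1] x) - (Φ^[n] x - Φ^[n - 1] x)| < ε) ∨
      (∀ n : ℕ, n > N → ∀ l : ℕ,
        |(Φi^[n + l * q] x - Φi^[n + l * q + 1] x) - (Φi^[n] x - Φi^[n + 1] x)| < ε) := by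
  have hmi : StrictMono Φi := fun a b hab => by
    rw [← hmono.lt_iff_lt, hinv₂ a, hinv₂ b]; exact hab
  have hci : Continuous Φi := hmi.monotone.continuous_of_surjective hinv₁.surjective
  have hli : ∀ x, Φi (x + 1) = Φi x + 1 := fun x => by
    apply hmono.injective
    rw [hlift, hinv₂, hinv₂]
  let F : CircleDeg1Lift := ⟨⟨Φ, hmono.monotone⟩, hlift⟩
  have hτ : F.translationNumber = p / q := F.translationNumber_eq_of_tendsto₀ (hrot 0)
  obtain ⟨w₀, hw₀⟩ := (F.translationNumber_eq_rat_iff hcont hq).1 hτ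
  rw [CircleDeg1Lift.coe_pow] at hw₀
  replace hw₀ : Φ^[q] w₀ = w₀ + p := hw₀
  obtain ⟨δ₁, hδ₁, hu₁⟩ := aux_unif Φ (aux_uc Φ hcont hlift) (ε / 2) (half_pos hε) q
  obtain ⟨δ₂, hδ₂, hu₂⟩ := aux_unif Φi (aux_uc Φi hci hli) (ε / 2) (half_pos hε) q
  obtain ⟨M, hM⟩ := aux_B (fun y => Φ^[q] y - p) (fun y => Φi^[q] y - ((-p : ℤ) : ℝ))
    ((hcont.iterate q).sub continuous_const) ((hci.iterate q).sub continuous_const)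
    (fun a b hab => sub_lt_sub_right (hmono.iterate q hab) _)
    (fun a b hab => sub_lt_sub_right (hmi.iterate q hab) _)
    (fun x => by simp only [aux_iter Φ hlift q]; ring)
    (fun x => by simp only [aux_iter Φi hli q]; ring)
    (fun x => by
      have := aux_int _ (aux_iter Φi hli q) (-p) (Φ^[q] x)
      rw [hinv₁.iterate q x] at this
      push_cast at this
      simp only [sub_eq_add_neg, this]
      push_cast; ring)
    (fun x => by
      have := aux_int _ (aux_iter Φ hlift q) p (Φi^[q] x)
      rw [hinv₂.iterate q x] at this
      push_cast
      simp only [sub_neg_eq_add, this]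
      ring)
    w₀ (by simp [hw₀]) (min δ₁ δ₂) (lt_min hδ₁ hδ₂)
  refine ⟨M * q, fun x => ?_⟩
  rcases hM x with h | h
  · left
    have key := aux_C Φ hlift q hq p δ₁ (ε / 2) M x hu₁
      (fun m hm l => lt_of_lt_of_le (h m hm l) (min_le_left _ _))
    intro n hn l
    have k1 := abs_lt.1 (key n hn.le l)
    have k2 := abs_lt.1 (key (n - 1) (by omega) l)
    rw [show n - 1 + l * q = n + l * q - 1 by omega] at k2
    rw [abs_lt]
    constructor <;> linarith [k1.1, k1.2, k2.1, k2.2]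
  · right
    have key := aux_C Φi hli q hq (-p) δ₂ (ε / 2) M x hu₂
      (fun m hm l => lt_of_lt_of_le (h m hm l) (min_le_right _ _))
    intro n hn l
    have k1 := abs_lt.1 (key n hn.le l)
    have k2 := abs_lt.1 (key (n + 1) (by omega) l)
    rw [show n + 1 + l * q = n + l * q + 1 by omega] at k2
    rw [abs_lt]
    constructor <;> linarith [k1.1, k1.2, k2.1, k2.2]
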